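/- arXiv:0812.4962 — 6 statements merged into one kernel-verified Lean document; each statement's English description precedes it below -/
import Mathlib

section
/- For every integer g ≥ 1 and all positive integers r, k, the Verlinde numbers satisfy the level-rank symmetry v_g(r,k) = v_g(k,r). -/
open Finset Real

/-- The Verlinde number `v_g(r,k)`. -/
noncomputable def verlinde (g r k : ℕ) : ℝ :=
  ((r : ℝ) + k) ^ (r * (g - 1)) *
    ∑ S ∈ (Finset.Icc 1 (r + k)).powersetCard r,
      ∏ p ∈ (S ×ˢ S).filter (fun p => p.1 ≠ p.2),
        |2 * Real.sin (((p.1 : ℝ) - (p.2 : ℝ)) * Real.pi / ((r : ℝ) + k))| ^ (1 - (g : ℤ))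

lemma prod_range_abs_two_mul_sin (m : ℕ) :
    ∏ j ∈ range m, |2 * sin (((j : ℝ) + 1) * π / ((m : ℝ) + 1))| = (m : ℝ) + 1 := by
  have h := congrArg norm
    (Complex.isPrimitiveRoot_exp (m + 1) m.succ_ne_zero).prod_one_sub_pow_eq_order
  rw [norm_prod] at h
  have hm : ‖(m : ℂ) + 1‖ = (m : ℝ) + 1 := by
    exact_mod_cast Complex.norm_natCast (m + 1)
  rw [hm] at h
  refine Eq.trans (prod_congr rfl fun j _ => ?_) h
  rw [norm_sub_rev, ← Complex.exp_nat_mul]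
  have hx : ((j + 1 : ℕ) : ℂ) * (2 * π * Complex.I / ((m + 1 : ℕ) : ℂ)) =
      Complex.I * ((2 * (((j : ℝ) + 1) * π / ((m : ℝ) + 1)) : ℝ) : ℂ) := by
    push_cast
    ring
  rw [hx, Complex.norm_exp_I_mul_ofReal_sub_one, mul_div_cancel_left₀ _ two_ne_zero, norm_eq_abs]

lemma prod_erase_abs_two_mul_sin {n s : ℕ} (hs : s ∈ Icc 1 n) :
    ∏ t ∈ (Icc 1 n).erase s, |2 * sin (((s : ℝ) - t) * π / n)| = n := by
  rw [mem_Icc] at hs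
  obtain ⟨m, rfl⟩ : ∃ m, n = m + 1 := ⟨n - 1, by omega⟩
  push_cast
  refine Eq.trans (prod_bij' (fun t _ => if t < s then s - t - 1 else m + s - t)
    (fun j _ => if j + 1 < s then s - j - 1 else m + s - j) ?_ ?_ ?_ ?_ ?_)
    (prod_range_abs_two_mul_sin m)
  · intro t ht
    simp only [mem_erase, mem_Icc, mem_range] at *
    split_ifs <;> omega
  · intro j hj
    simp only [mem_erase, mem_Icc, mem_range] at *
    split_ifs <;> omega
  · intro t ht
    simp only [mem_erase, mem_Icc] at *
    split_ifs <;> omega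
  · intro j hj
    simp only [mem_range] at *
    split_ifs <;> omega
  · intro t ht
    simp only [mem_erase, mem_Icc] at ht
    split_ifs with hts
    · have hc : ((s - t - 1 : ℕ) : ℝ) + 1 = s - t := by
        rw [← Nat.cast_sub hts.le, ← Nat.cast_add_one]
        congr 1
        omega
      rw [hc]
    · have hc : ((m + s - t : ℕ) : ℝ) = m + s - t := by
        rw [Nat.cast_sub (by omega), Nat.cast_add]
      have hx : ((m : ℝ) + s - t + 1) * π / (m + 1) = ((s : ℝ) - t) * π / (m + 1) + π := by
        field_simp
        ring
      rw [hc, hx, sin_add_pi, mul_neg, abs_neg]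

lemma prod_offDiag_mul_prod_sdiff {n : ℕ} {S : Finset ℕ} (hS : S ⊆ Icc 1 n) :
    (∏ p ∈ (S ×ˢ S).filter (fun p => p.1 ≠ p.2), |2 * sin (((p.1 : ℝ) - p.2) * π / n)|) *
      ∏ s ∈ S, ∏ t ∈ Icc 1 n \ S, |2 * sin (((s : ℝ) - t) * π / n)| = (n : ℝ) ^ #S := by
  rw [prod_filter, prod_product, ← prod_mul_distrib]
  refine prod_eq_pow_card fun s hs => ?_
  refine Eq.trans ?_ (prod_erase_abs_two_mul_sin (hS hs))
  rw [← prod_filter, mul_comm, ← prod_sdiff (erase_subset_erase s hS)]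
  congr 1
  · refine prod_congr ?_ fun _ _ => rfl
    grind
  · refine prod_congr ?_ fun _ _ => rfl
    grind

lemma verlinde_eq_sum_prod_sdiff (g r k : ℕ) (hg : 1 ≤ g) (hr : 0 < r) :
    verlinde g r k = ∑ S ∈ (Icc 1 (r + k)).powersetCard r,
      (∏ s ∈ S, ∏ t ∈ Icc 1 (r + k) \ S,
        |2 * sin (((s : ℝ) - t) * π / ((r : ℝ) + k))|) ^ (g - 1) := by
  rw [verlinde, mul_sum]
  refine sum_congr rfl fun S hS => ?_
  rw [mem_powersetCard] at hS
  have h := prod_offDiag_mul_prod_sdiff hS.1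
  rw [hS.2] at h
  push_cast at h
  have hn : ((r : ℝ) + k) ^ r ≠ 0 := by positivity
  have hD := left_ne_zero_of_mul (h.trans_ne hn)
  have he : (1 : ℤ) - g = -((g - 1 : ℕ) : ℤ) := by omega
  rw [prod_zpow, pow_mul, ← h, mul_pow, he, zpow_neg, zpow_natCast,
    mul_right_comm, mul_inv_cancel₀ (pow_ne_zero _ hD), one_mul]

/-- Level-rank symmetry of the Verlinde numbers: `v_g(r,k) = v_g(k,r)`. -/
theorem verlinde_symm (g r k : ℕ) (hg : 1 ≤ g) (hr : 0 < r) (hk : 0 < k) :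
    verlinde g r k = verlinde g k r := by
  rw [verlinde_eq_sum_prod_sdiff g r k hg hr, verlinde_eq_sum_prod_sdiff g k r hg hk,
    add_comm k r, add_comm (k : ℝ) r]
  have hcard (a b : ℕ) (S : Finset ℕ) (hab : a + b = r + k)
      (hS : S ∈ (Icc 1 (r + k)).powersetCard a) :
      Icc 1 (r + k) \ S ∈ (Icc 1 (r + k)).powersetCard b := by
    rw [mem_powersetCard] at *
    refine ⟨sdiff_subset, ?_⟩
    rw [card_sdiff_of_subset hS.1, Nat.card_Icc, hS.2]
    omega
  refine sum_bij' (fun S _ => Icc 1 (r + k) \ S) (fun S _ => Icc 1 (r + k) \ S)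
    (fun S => hcard r k S rfl) (fun S => hcard k r S (add_comm k r))
    (fun S hS => Finset.sdiff_sdiff_eq_self (mem_powersetCard.1 hS).1)
    (fun S hS => Finset.sdiff_sdiff_eq_self (mem_powersetCard.1 hS).1) fun S hS => ?_
  rw [Finset.sdiff_sdiff_eq_self (mem_powersetCard.1 hS).1, prod_comm]
  congr 1
  refine prod_congr rfl fun t _ => prod_congr rfl fun s _ => ?_
  rw [← neg_sub (t : ℝ) s, neg_mul, neg_div, sin_neg, mul_neg, abs_neg]
end

section
/- Let r, k be positive integers, set n = r+k, let δ be a positive divisor of gcd(r,k), let S̃ ⊆ {1,…,n/δ} with |S̃| = r/δ, and let S = ⋃_{i=0}^{δ−1} (S̃ + i·n/δ) ⊆ {1,…,n}, where S̃ + c = {s + c : s ∈ S̃}. Then Π_{(s,t) ∈ S×S, s ≠ t} |2 sin((s−t)π/n)| = δ^r · ( Π_{(s̃,t̃) ∈ S̃×S̃, s̃ ≠ t̃} |2 sin((s̃−t̃)δπ/n)| )^δ, where the products are over ordered pairs of distinct elements. -/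
open Finset Real

/-- The chord between two points of the unit circle. -/
theorem Complex.norm_exp_two_mul_I_sub (a b : ℝ) :
    ‖Complex.exp ((2 * a : ℝ) * Complex.I) - Complex.exp ((2 * b : ℝ) * Complex.I)‖ =
      |2 * Real.sin (a - b)| := by
  have h : Complex.exp ((2 * a : ℝ) * Complex.I) - Complex.exp ((2 * b : ℝ) * Complex.I) =
      Complex.exp ((a + b : ℝ) * Complex.I) *
        (((2 * Real.sin (a - b) : ℝ) : ℂ) * Complex.I) := by
    have h₁ : ((2 * a : ℝ) : ℂ) * Complex.I =
        (a + b : ℝ) * Complex.I + (a - b : ℝ) * Complex.I := by push_cast; ring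
    have h₂ : ((2 * b : ℝ) : ℂ) * Complex.I =
        (a + b : ℝ) * Complex.I + (-(a - b) : ℝ) * Complex.I := by push_cast; ring
    rw [h₁, h₂, Complex.exp_add, Complex.exp_add, Complex.exp_mul_I ((a - b : ℝ) : ℂ),
      Complex.exp_mul_I ((-(a - b) : ℝ) : ℂ)]
    push_cast
    rw [Complex.cos_neg, Complex.sin_neg]
    ring
  rw [h, norm_mul, norm_mul, Complex.norm_exp_ofReal_mul_I, Complex.norm_I, Complex.norm_real,
    Real.norm_eq_abs, one_mul, mul_one]

open Polynomial in
/-- `X ^ δ - 1` is the nodal polynomial of the `δ`-th roots of unity `exp (2 j π i / δ)`. -/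
theorem nodal_exp_eq_X_pow_sub_one {δ : ℕ} (hδ : 0 < δ) :
    Lagrange.nodal (range δ)
      (fun j : ℕ => Complex.exp ((2 * (j * π / δ) : ℝ) * Complex.I)) = (X ^ δ - 1 : ℂ[X]) := by
  have hζ := Complex.isPrimitiveRoot_exp δ hδ.ne'
  have h := X_pow_sub_C_eq_prod hζ hδ (one_pow δ)
  rw [C_1] at h
  rw [h, Lagrange.nodal]
  refine prod_congr rfl fun j _ => ?_
  rw [mul_one, ← Complex.exp_nat_mul]
  congr 3
  push_cast
  ring

theorem prod_abs_two_mul_sin_sub {δ : ℕ} (hδ : 0 < δ) (y : ℝ) :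
    ∏ j ∈ range δ, |2 * Real.sin (y - j * π / δ)| = |2 * Real.sin (δ * y)| := by
  have h := congrArg (fun p => ‖Polynomial.eval (Complex.exp ((2 * y : ℝ) * Complex.I)) p‖)
    (nodal_exp_eq_X_pow_sub_one hδ)
  simp only [Lagrange.eval_nodal, norm_prod, Complex.norm_exp_two_mul_I_sub] at h
  rw [h]
  have h' := Complex.norm_exp_two_mul_I_sub (δ * y) 0
  rw [sub_zero] at h'
  rw [← h']
  simp only [Polynomial.eval_sub, Polynomial.eval_pow, Polynomial.eval_X, Polynomial.eval_one,
    ← Complex.exp_nat_mul]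
  push_cast
  simp only [mul_zero, zero_mul, Complex.exp_zero]
  congr 3
  ring

theorem prod_erase_abs_two_mul_sin_sub {δ i : ℕ} (hi : i ∈ range δ) :
    ∏ j ∈ (range δ).erase i, |2 * Real.sin (i * π / δ - j * π / δ)| = δ := by
  have hδ : 0 < δ := (Nat.zero_le i).trans_lt (mem_range.mp hi)
  have h := Lagrange.eval_nodal_derivative_eval_node_eq
    (v := fun j : ℕ => Complex.exp ((2 * (j * π / δ) : ℝ) * Complex.I)) hi
  rw [nodal_exp_eq_X_pow_sub_one hδ, Lagrange.eval_nodal] at h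
  have h' := congrArg norm h
  simp only [norm_prod, Complex.norm_exp_two_mul_I_sub] at h'
  rw [← h']
  simp [Polynomial.derivative_X_pow, Complex.norm_exp]

/-- The row of the sine product of a coperiodic set, for the point `s + i * m`. -/
theorem prod_prod_abs_two_mul_sin_translates {δ m s i : ℕ} (hm : 0 < m) {T : Finset ℕ}
    (hinj : Set.InjOn (fun p : ℕ × ℕ => p.1 + p.2 * m) (T ×ˢ range δ : Finset (ℕ × ℕ)))
    (hs : s ∈ T) (hi : i ∈ range δ) :
    ∏ t ∈ T, ∏ j ∈ range δ, (if s + i * m ≠ t + j * m then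
        |2 * Real.sin ((((s + i * m : ℕ) : ℝ) - ((t + j * m : ℕ) : ℝ)) * π / (δ * m))| else 1) =
      δ * ∏ t ∈ T, (if s ≠ t then |2 * Real.sin (((s : ℝ) - t) * π / m)| else 1) := by
  have hδ : 0 < δ := (Nat.zero_le i).trans_lt (mem_range.mp hi)
  have hδ' : (δ : ℝ) ≠ 0 := by positivity
  have hm' : (m : ℝ) ≠ 0 := by positivity
  have hne : ∀ t ∈ T, ∀ j ∈ range δ, (s + i * m = t + j * m ↔ s = t ∧ i = j) := by
    intro t ht j hj
    have := hinj.eq_iff (x := (s, i)) (y := (t, j)) (by simp_all) (by simp_all)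
    simpa using this
  rw [← mul_prod_erase T _ hs, ← mul_prod_erase T (fun t => ite (s ≠ t) _ _) hs]
  simp only [ne_eq, not_true_eq_false, if_false, one_mul]
  congr 1
  · rw [← mul_prod_erase _ _ hi, if_neg (by simp), one_mul]
    refine (prod_congr rfl fun j hj => ?_).trans (prod_erase_abs_two_mul_sin_sub hi)
    rw [if_pos (by
      rw [hne s hs j (mem_of_mem_erase hj)]
      exact fun h => ne_of_mem_erase hj h.2.symm)]
    congr 3
    push_cast
    field_simp
    ring
  · refine prod_congr rfl fun t ht => ?_
    have hst : ¬ s = t := (ne_of_mem_erase ht).symm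
    rw [if_pos hst]
    have h := prod_abs_two_mul_sin_sub hδ (((s : ℝ) - t) * π / (δ * m) + i * π / δ)
    have hshift : (δ : ℝ) * (((s : ℝ) - t) * π / (δ * m) + i * π / δ) =
        ((s : ℝ) - t) * π / m + i * π := by field_simp
    rw [hshift, abs_mul, Real.sin_add_nat_mul_pi, abs_mul, abs_pow, abs_neg, abs_one, one_pow,
      one_mul, ← abs_mul] at h
    rw [← h]
    refine prod_congr rfl fun j hj => ?_
    rw [if_pos (by rw [hne t (mem_of_mem_erase ht) j hj]; exact fun h => hst h.1)]
    congr 3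
    push_cast
    field_simp
    ring

/-- Factorization of the sine product attached to a `δ`-coperiodic subset
`S = ⋃_{i=0}^{δ−1} (S̃ + i·(r+k)/δ)` of `{1,…,r+k}` in terms of the sine
product of its fundamental piece `S̃`. -/
theorem sin_prod_coperiodic (r k δ : ℕ) (hr : 0 < r) (hk : 0 < k) (hδ : 0 < δ)
    (hdvd : δ ∣ Nat.gcd r k)
    (T : Finset ℕ) (hT : T ⊆ Finset.Icc 1 ((r + k) / δ)) (hTcard : T.card = r / δ)
    (S : Finset ℕ)
    (hS : S = (Finset.range δ).biUnion (fun i => T.image (fun s => s + i * ((r + k) / δ)))) :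
    ∏ p ∈ (S ×ˢ S).filter (fun p => p.1 ≠ p.2),
        |2 * Real.sin (((p.1 : ℝ) - (p.2 : ℝ)) * Real.pi / ((r : ℝ) + k))| =
      (δ : ℝ) ^ r *
        (∏ p ∈ (T ×ˢ T).filter (fun p => p.1 ≠ p.2),
          |2 * Real.sin (((p.1 : ℝ) - (p.2 : ℝ)) * (δ : ℝ) * Real.pi / ((r : ℝ) + k))|) ^ δ := by
  have hδr : δ ∣ r := hdvd.trans (Nat.gcd_dvd_left r k)
  obtain ⟨m, hm⟩ : δ ∣ r + k := hδr.add (hdvd.trans (Nat.gcd_dvd_right r k))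
  have hm0 : 0 < m := Nat.pos_of_ne_zero (by rintro rfl; omega)
  have hdiv : (r + k) / δ = m := by rw [hm, Nat.mul_div_cancel_left _ hδ]
  have hcast : (r : ℝ) + k = δ * m := by exact_mod_cast hm
  have hδ' : (δ : ℝ) ≠ 0 := by positivity
  have hm' : (m : ℝ) ≠ 0 := by positivity
  rw [hdiv] at hT hS
  have hinj : Set.InjOn (fun p : ℕ × ℕ => p.1 + p.2 * m)
      (T ×ˢ range δ : Finset (ℕ × ℕ)) := by
    rintro ⟨s, i⟩ hsi ⟨t, j⟩ htj h
    simp only [coe_product, Set.mem_prod, mem_coe] at hsi htj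
    have hs := mem_Icc.mp (hT hsi.1)
    have ht := mem_Icc.mp (hT htj.1)
    dsimp only at h hs ht
    have hij : i = j := by
      rcases lt_trichotomy i j with hlt | heq | hlt
      · nlinarith
      · exact heq
      · nlinarith
    subst hij
    simpa using h
  have hS' : S = (T ×ˢ range δ).image (fun p : ℕ × ℕ => p.1 + p.2 * m) := by
    rw [hS]
    ext x
    simp only [mem_biUnion, mem_image, mem_product, Prod.exists]
    grind
  rw [prod_filter, prod_filter, prod_product, prod_product, hcast, hS', prod_image hinj,
    prod_product]
  simp only [prod_image hinj, prod_product]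
  rw [prod_congr rfl fun s hs => prod_congr rfl fun i hi =>
    prod_prod_abs_two_mul_sin_translates hm0 hinj hs hi]
  simp only [prod_const, card_range, mul_pow, prod_mul_distrib, prod_pow]
  rw [← pow_mul, hTcard, Nat.mul_div_cancel' hδr]
  congr 2
  refine prod_congr rfl fun s _ => prod_congr rfl fun t _ => ?_
  congr 4
  field_simp
end

section
/- Let r, k be positive integers and let S ⊆ {1,…,r+k} with |S| = r. Then a positive integer δ is a coperiod of S if and only if δ divides the largest coperiod δ_S of S; in particular the set of coperiods of S is exactly the set of positive divisors of δ_S. -/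
open Finset

/-- A positive integer `δ` is a coperiod of `S ⊆ {1,…,r+k}`, `|S| = r`, if `δ ∣ gcd(r,k)`
and `S = ⋃_{i=0}^{δ−1} (S̃ + i·(r+k)/δ)` for some `S̃ ⊆ {1,…,(r+k)/δ}` with `|S̃| = r/δ`. -/
def IsCoperiod (r k δ : ℕ) (S : Finset ℕ) : Prop :=
  δ ∣ Nat.gcd r k ∧
    ∃ T ⊆ Finset.Icc 1 ((r + k) / δ), T.card = r / δ ∧
      S = (Finset.range δ).biUnion (fun i => T.image (fun s => s + i * ((r + k) / δ)))

/-- The indicator of the `n`-periodic extension of `S` to the integers. -/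
def cyclicMem (n : ℕ) (S : Finset ℕ) (x : ℤ) : Prop :=
  ∃ s ∈ S, (n : ℤ) ∣ x - s

theorem cyclicMem_natCast_iff {n : ℕ} {S : Finset ℕ} (hS : S ⊆ Icc 1 n) {x : ℕ}
    (hx : x ∈ Icc 1 n) : cyclicMem n S x ↔ x ∈ S := by
  constructor
  · rintro ⟨s, hs, hd⟩
    have hs' := hS hs
    rw [mem_Icc] at hs' hx
    have h0 : (x : ℤ) - s = 0 := by
      apply Int.eq_zero_of_abs_lt_dvd hd
      rw [abs_lt]
      constructor <;> omega
    have : x = s := by omega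
    exact this ▸ hs
  · exact fun h => ⟨x, h, by simp⟩

theorem periodic_cyclicMem_biUnion {m δ : ℕ} (hδ : 0 < δ) (T : Finset ℕ) :
    Function.Periodic (cyclicMem (δ * m)
      ((range δ).biUnion fun i => T.image fun s => s + i * m)) (m : ℤ) := by
  have key : ∀ x : ℤ, cyclicMem (δ * m)
      ((range δ).biUnion fun i => T.image fun s => s + i * m) x ↔
      ∃ t ∈ T, (m : ℤ) ∣ x - t := by
    intro x
    simp only [cyclicMem, mem_biUnion, mem_image, mem_range]
    constructor
    · rintro ⟨_, ⟨i, -, t, ht, rfl⟩, c, hc⟩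
      refine ⟨t, ht, δ * c + i, ?_⟩
      push_cast at hc
      linear_combination hc
    · rintro ⟨t, ht, q, hq⟩
      have hδ' : (0 : ℤ) < δ := by exact_mod_cast hδ
      have h0 := Int.emod_nonneg q hδ'.ne'
      have h1 := Int.emod_lt_of_pos q hδ'
      have h2 := Int.emod_add_mul_ediv q δ
      obtain ⟨i, hi⟩ := Int.eq_ofNat_of_zero_le h0
      rw [hi] at h1 h2
      refine ⟨t + i * m, ⟨i, by exact_mod_cast h1, t, ht, rfl⟩, q / δ, ?_⟩
      push_cast
      linear_combination hq - (m : ℤ) * h2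
  intro x
  simp only [key, add_sub_right_comm, dvd_add_self_right]

theorem eq_biUnion_of_periodic_cyclicMem {m δ : ℕ} (hm : 0 < m) {S : Finset ℕ}
    (hS : S ⊆ Icc 1 (δ * m)) (hper : Function.Periodic (cyclicMem (δ * m) S) (m : ℤ)) :
    S = (range δ).biUnion fun i => {s ∈ S | s ≤ m}.image fun s => s + i * m := by
  have shift (t i : ℕ) (h₁ : t ∈ Icc 1 (δ * m)) (h₂ : t + i * m ∈ Icc 1 (δ * m)) :
      t + i * m ∈ S ↔ t ∈ S := by
    rw [← cyclicMem_natCast_iff hS h₁, ← cyclicMem_natCast_iff hS h₂]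
    have := hper.nat_mul i t
    push_cast
    rw [this]
  ext x
  simp only [mem_biUnion, mem_image, mem_range, mem_filter]
  constructor
  · intro hx
    have hx' := hS hx
    have hx'' := mem_Icc.1 hx'
    have hdm := Nat.mod_add_div' (x - 1) m
    have hlt := Nat.mod_lt (x - 1) hm
    have hi : (x - 1) / m < δ := by
      rw [Nat.div_lt_iff_lt_mul hm]
      omega
    have hxe : (x - 1) % m + 1 + (x - 1) / m * m = x := by omega
    refine ⟨(x - 1) / m, hi, (x - 1) % m + 1, ⟨?_, hlt⟩, hxe⟩
    refine (shift _ ((x - 1) / m) ?_ ?_).1 ?_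
    · rw [mem_Icc]
      omega
    · rwa [hxe]
    · rwa [hxe]
  · rintro ⟨i, hi, t, ⟨ht, htm⟩, rfl⟩
    refine (shift t i (hS ht) ?_).2 ht
    have h1 := (mem_Icc.1 (hS ht)).1
    have : (i + 1) * m ≤ δ * m := Nat.mul_le_mul_right m hi
    rw [add_mul, one_mul] at this
    rw [mem_Icc]
    omega

theorem card_biUnion_image_add_mul {m : ℕ} (δ : ℕ) {T : Finset ℕ} (hT : T ⊆ Icc 1 m) :
    ((range δ).biUnion fun i => T.image fun s => s + i * m).card = δ * T.card := by
  rw [card_biUnion]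
  · simp [card_image_of_injective _ (add_left_injective _)]
  · intro i _ j _ hij
    rw [Function.onFun, disjoint_left]
    intro x hx hy
    obtain ⟨s, hs, rfl⟩ := mem_image.1 hx
    obtain ⟨t, ht, h⟩ := mem_image.1 hy
    have hs' := mem_Icc.1 (hT hs)
    have ht' := mem_Icc.1 (hT ht)
    rcases lt_or_gt_of_ne hij with hlt | hlt
    · have : (i + 1) * m ≤ j * m := Nat.mul_le_mul_right m hlt
      linarith
    · have : (j + 1) * m ≤ i * m := Nat.mul_le_mul_right m hlt
      linarith

theorem isCoperiod_iff_periodic {r k δ : ℕ} (hr : 0 < r) (hδ : 0 < δ) {S : Finset ℕ}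
    (hS : S ⊆ Icc 1 (r + k)) (hScard : S.card = r) :
    IsCoperiod r k δ S ↔ δ ∣ Nat.gcd r k ∧
      Function.Periodic (cyclicMem (r + k) S) (((r + k) / δ : ℕ) : ℤ) := by
  refine and_congr_right fun hd => ?_
  obtain ⟨m, hm⟩ : δ ∣ r + k :=
    dvd_add (hd.trans (Nat.gcd_dvd_left r k)) (hd.trans (Nat.gcd_dvd_right r k))
  rw [hm] at hS ⊢
  rw [Nat.mul_div_cancel_left m hδ]
  constructor
  · rintro ⟨T, -, -, rfl⟩
    exact periodic_cyclicMem_biUnion hδ T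
  · intro hper
    have hm0 : 0 < m := Nat.pos_of_ne_zero (by rintro rfl; omega)
    have heq := eq_biUnion_of_periodic_cyclicMem hm0 hS hper
    have hT : {s ∈ S | s ≤ m} ⊆ Icc 1 m := by
      intro s hs
      rw [mem_filter] at hs
      exact mem_Icc.2 ⟨(mem_Icc.1 (hS hs.1)).1, hs.2⟩
    refine ⟨_, hT, ?_, heq⟩
    have hcard := congrArg card heq
    rw [card_biUnion_image_add_mul δ hT, hScard] at hcard
    exact (Nat.div_eq_of_eq_mul_right hδ hcard).symm

theorem periodic_div_lcm {α : Type*} {f : ℤ → α} {n a b : ℕ} (ha : 0 < a) (hb : 0 < b)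
    (han : a ∣ n) (hbn : b ∣ n) (hfa : Function.Periodic f ((n / a : ℕ) : ℤ))
    (hfb : Function.Periodic f ((n / b : ℕ) : ℤ)) :
    Function.Periodic f ((n / a.lcm b : ℕ) : ℤ) := by
  obtain ⟨m, rfl⟩ := Nat.lcm_dvd han hbn
  obtain ⟨p, hp⟩ := Nat.dvd_lcm_left a b
  obtain ⟨q, hq⟩ := Nat.dvd_lcm_right a b
  have hL : 0 < a.lcm b := Nat.lcm_pos ha hb
  have hpq : p.gcd q = 1 := by
    have hdvd : a.lcm b * p.gcd q ∣ a.lcm b := by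
      obtain ⟨p', hp'⟩ := Nat.gcd_dvd_left p q
      obtain ⟨q', hq'⟩ := Nat.gcd_dvd_right p q
      obtain ⟨c, hc⟩ : a.lcm b ∣ a * p' := by
        refine Nat.lcm_dvd (dvd_mul_right _ _) ⟨q', ?_⟩
        have hg : 0 < p.gcd q := Nat.gcd_pos_of_pos_left _
          (Nat.pos_of_ne_zero (by rintro rfl; omega))
        apply Nat.eq_of_mul_eq_mul_left hg
        calc p.gcd q * (a * p') = a * (p.gcd q * p') := by ring
          _ = b * (p.gcd q * q') := by rw [← hp', ← hq', ← hp, ← hq]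
          _ = p.gcd q * (b * q') := by ring
      refine ⟨c, ?_⟩
      calc a.lcm b = a * (p.gcd q * p') := by rw [← hp', ← hp]
        _ = p.gcd q * (a * p') := by ring
        _ = a.lcm b * p.gcd q * c := by rw [hc]; ring
    exact Nat.dvd_one.1 (Nat.dvd_of_mul_dvd_mul_left hL (by simpa using hdvd))
  have h1 : a.lcm b * m / a = p * m := by
    rw [hp, mul_assoc, Nat.mul_div_cancel_left _ ha]
  have h2 : a.lcm b * m / b = q * m := by
    rw [hq, mul_assoc, Nat.mul_div_cancel_left _ hb]
  rw [h1] at hfa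
  rw [h2] at hfb
  rw [Nat.mul_div_cancel_left _ hL]
  have hbez := Nat.gcd_eq_gcd_ab p q
  rw [hpq] at hbez
  have hm : (m : ℤ) = p.gcdA q * ((p * m : ℕ) : ℤ) + p.gcdB q * ((q * m : ℕ) : ℤ) := by
    push_cast at hbez ⊢
    linear_combination (m : ℤ) * hbez
  rw [hm]
  exact (hfa.int_mul _).add_period (hfb.int_mul _)

/-- A positive integer `δ` is a coperiod of `S` if and only if `δ` divides the largest
coperiod `δ_S` of `S`; in particular the coperiods of `S` are exactly the positive
divisors of `δ_S`. -/
theorem isCoperiod_iff_dvd_largest (r k : ℕ) (hr : 0 < r) (hk : 0 < k)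
    (S : Finset ℕ) (hS : S ⊆ Finset.Icc 1 (r + k)) (hScard : S.card = r)
    (δS : ℕ) (hδS : 0 < δS) (hδSco : IsCoperiod r k δS S)
    (hmax : ∀ δ : ℕ, 0 < δ → IsCoperiod r k δ S → δ ≤ δS) :
    ∀ δ : ℕ, 0 < δ → (IsCoperiod r k δ S ↔ δ ∣ δS) := by
  intro δ hδ
  have hgcd : r.gcd k ∣ r + k := dvd_add (Nat.gcd_dvd_left r k) (Nat.gcd_dvd_right r k)
  obtain ⟨hdS, hperS⟩ := (isCoperiod_iff_periodic hr hδS hS hScard).1 hδSco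
  constructor
  · intro h
    obtain ⟨hd, hper⟩ := (isCoperiod_iff_periodic hr hδ hS hScard).1 h
    have hL : 0 < δ.lcm δS := Nat.lcm_pos hδ hδS
    have hle : δ.lcm δS ≤ δS := hmax _ hL <|
      (isCoperiod_iff_periodic hr hL hS hScard).2 ⟨Nat.lcm_dvd hd hdS,
        periodic_div_lcm hδ hδS (hd.trans hgcd) (hdS.trans hgcd) hper hperS⟩
    have heq : δ.lcm δS = δS := hle.antisymm (Nat.le_of_dvd hL (Nat.dvd_lcm_right δ δS))
    exact heq ▸ Nat.dvd_lcm_left δ δS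
  · intro h
    refine (isCoperiod_iff_periodic hr hδ hS hScard).2 ⟨h.trans hdS, ?_⟩
    obtain ⟨c, hc⟩ := Nat.div_dvd_div_left (hdS.trans hgcd) h
    rw [hc, mul_comm, Nat.cast_mul]
    exact hperS.nat_mul c
end

section
/- Let g ≥ 1 and h ≥ 1 be integers, and let ξ : (ℤ/hℤ)^{2g} → ℂ^× be a group homomorphism (character) of order exactly ω. Then for every positive divisor δ of h, Σ_{α} ξ(α)^{−1} = (h/δ)^{2g} · {(h/ω)/(h/δ)}_g, where the sum is over all elements α of (ℤ/hℤ)^{2g} of order exactly h/δ. -/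
open Finset
open scoped Classical

/-- The genus-`g` symbol `{λ/h}_g`. It equals `1` for `h = 1`; for `h = p_1^{a_1}···p_n^{a_n} ≥ 2`
it is `0` unless `p_1^{a_1−1}···p_n^{a_n−1} ∣ λ`, in which case it equals
`∏_i (ε_i − p_i^{−2g})` where `ε_i = 1` if `p_i^{a_i} ∣ λ` and `ε_i = 0` otherwise. -/
noncomputable def genusSymbol (g lam h : ℕ) : ℝ :=
  if h = 1 then 1
  else if (∏ p ∈ h.primeFactors, p ^ (h.factorization p - 1)) ∣ lam then
    ∏ p ∈ h.primeFactors,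
      ((if p ^ (h.factorization p) ∣ lam then (1 : ℝ) else 0) - (p : ℝ) ^ (-(2 * (g : ℤ))))
  else 0

/-- The local factor at `p` of `{λ/h}_g`, where `a` is the exponent of `p` in `h`. -/
noncomputable def genusLocalFactor (g lam p a : ℕ) : ℝ :=
  if p ^ (a - 1) ∣ lam then
    (if p ^ a ∣ lam then (1 : ℝ) else 0) - (p : ℝ) ^ (-(2 * (g : ℤ)))
  else 0

theorem genusSymbol_eq_factorization_prod (g lam h : ℕ) :
    genusSymbol g lam h = h.factorization.prod (genusLocalFactor g lam) := by
  unfold genusSymbol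
  split_ifs with h1 hdvd
  · simp [h1]
  · refine Finset.prod_congr (by simp) fun p hp => ?_
    have : p ^ (h.factorization p - 1) ∣ lam :=
      (Finset.dvd_prod_of_mem (fun p => p ^ (h.factorization p - 1)) hp).trans hdvd
    simp [genusLocalFactor, this]
  · have hex : ∃ p ∈ h.primeFactors, ¬ p ^ (h.factorization p - 1) ∣ lam := by
      by_contra! hall
      refine hdvd (Finset.prod_dvd_of_isRelPrime (fun p hp q hq hpq => ?_) hall)
      exact Nat.coprime_iff_isRelPrime.1 (Nat.Coprime.pow _ _
        ((Nat.coprime_primes (Nat.prime_of_mem_primeFactors hp)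
          (Nat.prime_of_mem_primeFactors hq)).2 hpq))
    obtain ⟨p, hp, hnd⟩ := hex
    exact (Finset.prod_eq_zero (i := p) (by simpa using hp) (by simp [genusLocalFactor, hnd])).symm

theorem genusSymbol_mul (g lam : ℕ) {m n : ℕ} (hmn : m.Coprime n) :
    genusSymbol g lam (m * n) = genusSymbol g lam m * genusSymbol g lam n := by
  simp only [genusSymbol_eq_factorization_prod]
  rw [Nat.factorization_mul_of_coprime hmn,
    Finsupp.prod_add_index_of_disjoint (by simpa using hmn.disjoint_primeFactors)]

theorem genusSymbol_prime_pow (g lam : ℕ) {p k : ℕ} (hp : p.Prime) (hk : k ≠ 0) :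
    genusSymbol g lam (p ^ k) = genusLocalFactor g lam p k := by
  rw [genusSymbol_eq_factorization_prod, hp.factorization_pow, Finsupp.prod,
    Finsupp.support_single _ hk]
  simp

/-- The arithmetic function `n ↦ n ^ (2g) · {λ/n}_g`. -/
noncomputable def genusArith (g lam : ℕ) : ArithmeticFunction ℝ where
  toFun n := if n = 0 then 0 else (n : ℝ) ^ (2 * g) * genusSymbol g lam n
  map_zero' := if_pos rfl

/-- The arithmetic function equal to `n ^ (2g)` at the divisors `n` of `λ` and to `0` elsewhere. -/
noncomputable def divisorPowArith (g lam : ℕ) : ArithmeticFunction ℝ where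
  toFun n := if n ≠ 0 ∧ n ∣ lam then (n : ℝ) ^ (2 * g) else 0
  map_zero' := by simp

theorem isMultiplicative_genusArith (g lam : ℕ) : (genusArith g lam).IsMultiplicative := by
  refine ArithmeticFunction.IsMultiplicative.iff_ne_zero.2 ⟨by simp [genusArith, genusSymbol], ?_⟩
  intro m n hm hn hmn
  simp only [genusArith, ArithmeticFunction.coe_mk, hm, hn, mul_eq_zero, or_self, if_false,
    genusSymbol_mul g lam hmn, Nat.cast_mul, mul_pow]
  ring

theorem isMultiplicative_divisorPowArith (g lam : ℕ) :
    (divisorPowArith g lam).IsMultiplicative := by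
  refine ArithmeticFunction.IsMultiplicative.iff_ne_zero.2 ⟨by simp [divisorPowArith], ?_⟩
  intro m n hm hn hmn
  have : m * n ∣ lam ↔ m ∣ lam ∧ n ∣ lam :=
    ⟨fun h => ⟨dvd_of_mul_right_dvd h, dvd_of_mul_left_dvd h⟩,
      fun h => hmn.mul_dvd_of_dvd_of_dvd h.1 h.2⟩
  by_cases h1 : m ∣ lam <;> by_cases h2 : n ∣ lam <;>
    simp [divisorPowArith, hm, hn, this, h1, h2, mul_pow]

theorem genusArith_mul_zeta (g lam : ℕ) :
    genusArith g lam * ArithmeticFunction.zeta = divisorPowArith g lam := by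
  refine (ArithmeticFunction.IsMultiplicative.eq_iff_eq_on_prime_powers _
    ((isMultiplicative_genusArith g lam).mul
      ArithmeticFunction.isMultiplicative_zeta.natCast) _
    (isMultiplicative_divisorPowArith g lam)).2 fun p k hp => ?_
  rw [ArithmeticFunction.coe_mul_zeta_apply, Nat.sum_divisors_prime_pow hp]
  induction k with
  | zero => simp [genusArith, divisorPowArith, genusSymbol]
  | succ k ih =>
    rw [Finset.sum_range_succ, ih]
    have hp0 : (p : ℝ) ≠ 0 := by exact_mod_cast hp.ne_zero
    have hpow : (p : ℝ) ^ (-(2 * (g : ℤ))) = ((p : ℝ) ^ (2 * g))⁻¹ := by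
      rw [zpow_neg]; norm_cast
    simp only [genusArith, divisorPowArith, ArithmeticFunction.coe_mk,
      genusSymbol_prime_pow g lam hp k.add_one_ne_zero, genusLocalFactor, hpow, pow_eq_zero_iff',
      hp.ne_zero, ne_eq, false_and, not_false_eq_true, true_and, if_false, Nat.add_sub_cancel]
    by_cases h1 : p ^ (k + 1) ∣ lam
    · have h0 : p ^ k ∣ lam := (pow_dvd_pow p k.le_succ).trans h1
      simp only [h0, h1, if_true]
      push_cast
      field_simp
      ring
    · by_cases h0 : p ^ k ∣ lam
      · simp only [h0, h1, if_true, if_false]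
        push_cast
        field_simp
        ring
      · simp [h0, h1]

theorem sum_divisors_pow_mul_genusSymbol (g lam : ℕ) {n : ℕ} (hn : n ≠ 0) :
    ∑ e ∈ n.divisors, (e : ℝ) ^ (2 * g) * genusSymbol g lam e =
      if n ∣ lam then (n : ℝ) ^ (2 * g) else 0 := by
  have key := congrArg (fun f : ArithmeticFunction ℝ => f n) (genusArith_mul_zeta g lam)
  simp only [ArithmeticFunction.coe_mul_zeta_apply] at key
  rw [show divisorPowArith g lam n = if n ∣ lam then (n : ℝ) ^ (2 * g) else 0 by
    simp [divisorPowArith, hn]] at key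
  rw [← key]
  refine Finset.sum_congr rfl fun e he => ?_
  simp [genusArith, (Nat.pos_of_mem_divisors he).ne']

theorem ZMod.card_filter_nsmul_eq_zero {h d : ℕ} [NeZero h] (hd : d ∣ h) :
    (Finset.univ.filter fun x : ZMod h => d • x = 0).card = d := by
  have key := IsAddCyclic.card_nsmulAddMonoidHom_ker (G := ZMod h) d
  rw [Nat.card_zmod, Nat.gcd_eq_right hd] at key
  rw [Nat.card_eq_fintype_card, Fintype.card_subtype] at key
  simpa only [AddMonoidHom.mem_ker, nsmulAddMonoidHom_apply] using key

theorem card_filter_pow_eq_one_pi_zmod {h d n : ℕ} [NeZero h] (hd : d ∣ h) :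
    (Finset.univ.filter fun α : Multiplicative (Fin n → ZMod h) => α ^ d = 1).card = d ^ n := by
  have hpi : (Finset.univ.filter fun x : Fin n → ZMod h => d • x = 0) =
      Fintype.piFinset fun _ => Finset.univ.filter fun y : ZMod h => d • y = 0 := by
    ext x
    simp only [Finset.mem_filter, Finset.mem_univ, true_and, Fintype.mem_piFinset]
    exact funext_iff
  calc _ = (Finset.univ.filter fun x : Fin n → ZMod h => d • x = 0).card :=
        Finset.card_equiv Multiplicative.toAdd fun α => by
          simp only [Finset.mem_filter, Finset.mem_univ, true_and]
          exact Iff.rfl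
    _ = d ^ n := by rw [hpi, Fintype.card_piFinset_const, ZMod.card_filter_nsmul_eq_zero hd]

theorem exists_pow_eq_of_pow_eq_one_pi_zmod {h d n : ℕ} [NeZero h] (hd : d ∣ h)
    {α : Multiplicative (Fin n → ZMod h)} (hα : α ^ d = 1) : ∃ β, β ^ (h / d) = α := by
  have hd0 : 0 < d := Nat.pos_of_dvd_of_pos hd (NeZero.pos h)
  have key : ∀ i, h / d ∣ (α.toAdd i).val := fun i => by
    have h0 : d • α.toAdd i = 0 := congrFun (congrArg Multiplicative.toAdd hα) i
    rw [nsmul_eq_mul, ← ZMod.natCast_zmod_val (α.toAdd i), ← Nat.cast_mul,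
      ZMod.natCast_eq_zero_iff] at h0
    exact (Nat.div_dvd_iff_dvd_mul hd hd0).2 h0
  choose c hc using key
  refine ⟨Multiplicative.ofAdd fun i => (c i : ZMod h), ?_⟩
  apply Multiplicative.toAdd.injective
  funext i
  change (h / d) • (c i : ZMod h) = α.toAdd i
  rw [nsmul_eq_mul, ← Nat.cast_mul, ← hc i, ZMod.natCast_zmod_val]

theorem pow_eq_one_pi_zmod {h n : ℕ} (β : Multiplicative (Fin n → ZMod h)) : β ^ h = 1 := by
  apply Multiplicative.toAdd.injective
  funext i
  change h • β.toAdd i = 0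
  simp

theorem orderOf_char_dvd {h n : ℕ} (ξ : Multiplicative (Fin n → ZMod h) →* ℂˣ) :
    orderOf ξ ∣ h := by
  refine orderOf_dvd_of_pow_eq_one (MonoidHom.ext fun β => ?_)
  rw [MonoidHom.pow_apply, ← map_pow, pow_eq_one_pi_zmod, map_one, MonoidHom.one_apply]

/-- A character is trivial on the `d`-torsion exactly when `d` divides `h` over its order. -/
theorem char_trivial_on_torsion_iff {h d n : ℕ} [NeZero h] (hd : d ∣ h)
    (ξ : Multiplicative (Fin n → ZMod h) →* ℂˣ) :
    (∀ α, α ^ d = 1 → ξ α = 1) ↔ d ∣ h / orderOf ξ := by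
  have hω := orderOf_char_dvd ξ
  have hcomm : d ∣ h / orderOf ξ ↔ orderOf ξ ∣ h / d := by
    rw [Nat.dvd_div_iff_mul_dvd hω, Nat.dvd_div_iff_mul_dvd hd, mul_comm]
  rw [hcomm, orderOf_dvd_iff_pow_eq_one]
  constructor
  · intro htriv
    refine MonoidHom.ext fun β => ?_
    rw [MonoidHom.pow_apply, ← map_pow, MonoidHom.one_apply]
    refine htriv _ ?_
    rw [← pow_mul, Nat.div_mul_cancel hd]
    exact pow_eq_one_pi_zmod β
  · intro hξ α hα
    obtain ⟨β, rfl⟩ := exists_pow_eq_of_pow_eq_one_pi_zmod hd hα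
    rw [map_pow, ← MonoidHom.pow_apply, hξ, MonoidHom.one_apply]

theorem sum_char_inv_torsion {h d n : ℕ} [NeZero h] (hd : d ∣ h)
    (ξ : Multiplicative (Fin n → ZMod h) →* ℂˣ) :
    ∑ α ∈ Finset.univ.filter (fun α : Multiplicative (Fin n → ZMod h) => α ^ d = 1),
        ((ξ α : ℂ))⁻¹ = if d ∣ h / orderOf ξ then (d : ℂ) ^ n else 0 := by
  simp only [← char_trivial_on_torsion_iff hd ξ]
  split_ifs with htriv
  · rw [Finset.sum_congr rfl (g := fun _ => (1 : ℂ)) fun α hα => by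
      simp [htriv α (Finset.mem_filter.1 hα).2]]
    rw [Finset.sum_const, card_filter_pow_eq_one_pi_zmod hd]
    simp
  · push Not at htriv
    obtain ⟨β, hβ, hξβ⟩ := htriv
    set S := ∑ α ∈ Finset.univ.filter (fun α : Multiplicative (Fin n → ZMod h) => α ^ d = 1),
        ((ξ α : ℂ))⁻¹ with hS
    have hshift : (ξ β : ℂ)⁻¹ * S = S := by
      rw [hS, Finset.mul_sum]
      refine Finset.sum_equiv (Equiv.mulLeft β) (fun α => ?_) fun α _ => ?_
      · simp [mul_pow, hβ]
      · simp [mul_comm]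
    have hne : (ξ β : ℂ)⁻¹ ≠ 1 := by
      simpa [inv_eq_one, Units.val_eq_one] using hξβ
    by_contra hS0
    exact hne (mul_right_cancel₀ hS0 (by rw [hshift, one_mul]))

theorem sum_divisors_sum_orderOf_eq {G M : Type*} [Group G] [Fintype G] [DecidableEq G] [AddCommMonoid M]
    (f : G → M) {n : ℕ} (hn : n ≠ 0) :
    ∑ e ∈ n.divisors, ∑ α ∈ Finset.univ.filter (fun α : G => orderOf α = e), f α =
      ∑ α ∈ Finset.univ.filter (fun α : G => α ^ n = 1), f α := by
  rw [← Finset.sum_fiberwise_of_maps_to (g := orderOf) (t := n.divisors)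
    fun α hα => Nat.mem_divisors.2 ⟨orderOf_dvd_of_pow_eq_one (Finset.mem_filter.1 hα).2, hn⟩]
  refine Finset.sum_congr rfl fun e he => Finset.sum_congr ?_ fun _ _ => rfl
  ext α
  simp only [Finset.mem_filter, Finset.mem_univ, true_and, iff_and_self]
  rintro rfl
  exact orderOf_dvd_iff_pow_eq_one.1 (Nat.dvd_of_mem_divisors he)

/-- Functions with equal divisor sums at every divisor of `m` agree at `m`. -/
theorem eq_of_sum_divisors_eq {M : Type*} [AddCommGroup M] {f₁ f₂ : ℕ → M} {m : ℕ} (hm : m ≠ 0)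
    (hsum : ∀ n, n ∣ m → ∑ e ∈ n.divisors, f₁ e = ∑ e ∈ n.divisors, f₂ e) : f₁ m = f₂ m := by
  induction m using Nat.strong_induction_on with
  | _ m ih =>
    have key := hsum m dvd_rfl
    rw [← Nat.cons_self_properDivisors hm, Finset.sum_cons, Finset.sum_cons,
      Finset.sum_congr rfl (g := f₂) fun e he => ?_] at key
    · exact add_right_cancel key
    · obtain ⟨hem, hlt⟩ := Nat.mem_properDivisors.1 he
      exact ih e hlt (ne_zero_of_dvd_ne_zero hm hem) fun n hn => hsum n (hn.trans hem)

/-- For a character `ξ` of `(ℤ/hℤ)^{2g}` of order exactly `ω` and a positive divisor `δ` of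
`h`, the sum of `ξ(α)⁻¹` over the elements `α` of order exactly `h/δ` equals
`(h/δ)^{2g} · {(h/ω)/(h/δ)}_g`. -/
theorem sum_char_inv_order (g h ω δ : ℕ) [NeZero h] (hg : 1 ≤ g) (hh : 0 < h)
    (ξ : Multiplicative (Fin (2 * g) → ZMod h) →* ℂˣ) (hξ : orderOf ξ = ω)
    (hδ : 0 < δ) (hdvd : δ ∣ h) :
    ∑ α ∈ Finset.univ.filter
        (fun α : Multiplicative (Fin (2 * g) → ZMod h) => orderOf α = h / δ),
        ((ξ α : ℂ))⁻¹ =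
      ((((h / δ : ℕ) : ℝ) ^ (2 * g) * genusSymbol g (h / ω) (h / δ) : ℝ) : ℂ) := by
  subst hξ
  have hm : h / δ ∣ h := Nat.div_dvd_of_dvd hdvd
  refine eq_of_sum_divisors_eq (m := h / δ)
    (f₁ := fun m => ∑ α ∈ Finset.univ.filter
      (fun α : Multiplicative (Fin (2 * g) → ZMod h) => orderOf α = m), ((ξ α : ℂ))⁻¹)
    (f₂ := fun m => (((m : ℝ) ^ (2 * g) * genusSymbol g (h / orderOf ξ) m : ℝ) : ℂ))
    (ne_zero_of_dvd_ne_zero hh.ne' hm) fun n hn => ?_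
  have hn0 : n ≠ 0 := ne_zero_of_dvd_ne_zero hh.ne' (hn.trans hm)
  rw [sum_divisors_sum_orderOf_eq _ hn0, sum_char_inv_torsion (hn.trans hm), ← Complex.ofReal_sum,
    sum_divisors_pow_mul_genusSymbol g _ hn0]
  split_ifs <;> simp
end

section
/- Let g ≥ 1 be an integer, h a positive integer, r, k coprime positive integers, and ω a positive divisor of h. Then the multiplicities satisfy the level-rank symmetry m_ω(r,k) = m_ω(k,r). -/
open Finset Real

/-- The multiplicity `m_ω(r,k)` of the semihomogeneous factor attached to a character of
order `ω` in the splitting of the Verlinde bundle `E_{hr,hk}`. -/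
noncomputable def mult (g h r k ω : ℕ) : ℝ :=
  ∑ δ ∈ h.divisors,
    (1 / (((r : ℝ) + k) ^ g * (δ : ℝ) ^ (2 * g))) * genusSymbol g (h / ω) (h / δ) *
      verlinde ((h / δ) * (g - 1) + 1) (r * δ) (k * δ)

/-- The chord length `|2 sin((s - t)π/n)|` between the `s`-th and `t`-th of the `n`-th roots of
unity. -/
noncomputable def chord (n s t : ℕ) : ℝ :=
  |2 * Real.sin (((s : ℝ) - (t : ℝ)) * Real.pi / (n : ℝ))|

lemma chord_comm (n s t : ℕ) : chord n s t = chord n t s := by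
  unfold chord
  rw [← abs_neg, ← mul_neg, ← Real.sin_neg]
  congr 3
  ring

lemma chord_add_left {n : ℕ} (hn : n ≠ 0) (s t : ℕ) : chord n (s + n) t = chord n s t := by
  have hn' : (n : ℝ) ≠ 0 := by exact_mod_cast hn
  unfold chord
  have h : (((s + n : ℕ) : ℝ) - t) * Real.pi / n = ((s : ℝ) - t) * Real.pi / n + Real.pi := by
    push_cast
    field_simp
    ring
  rw [h, Real.sin_add_pi, mul_neg, abs_neg]

lemma chord_eq_chord_zero {n s t a : ℕ} (h : s = t + a) : chord n s t = chord n a 0 := by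
  subst h
  simp [chord]

lemma chord_zero_eq_norm (n a : ℕ) :
    chord n a 0 = ‖1 - Complex.exp (2 * Real.pi * Complex.I / n) ^ a‖ := by
  have h : Complex.exp (2 * Real.pi * Complex.I / n) ^ a =
      Complex.exp (Complex.I * ((2 * (a * Real.pi / n) : ℝ) : ℂ)) := by
    rw [← Complex.exp_nat_mul]
    congr 1
    push_cast
    ring
  rw [norm_sub_rev, h, Complex.norm_exp_I_mul_ofReal_sub_one, Real.norm_eq_abs, chord]
  congr 3
  push_cast
  ring

lemma prod_chord_zero {n : ℕ} (hn : n ≠ 0) : ∏ a ∈ Ico 1 n, chord n a 0 = n := by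
  obtain ⟨m, rfl⟩ := Nat.exists_eq_succ_of_ne_zero hn
  have h := (Complex.isPrimitiveRoot_exp (m + 1) hn).prod_one_sub_pow_eq_order
  have h' := congrArg norm h
  rw [norm_prod] at h'
  rw [Finset.prod_Ico_eq_prod_range]
  simp only [chord_zero_eq_norm, Nat.succ_eq_add_one, Nat.add_sub_cancel]
  simp only [add_comm 1]
  rw [h']
  exact_mod_cast Complex.norm_natCast (m + 1)

/-- The product of the distances from one `n`-th root of unity to all the others is `n`. -/
lemma prod_chord_erase {n s : ℕ} (hs : s ∈ Icc 1 n) :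
    ∏ t ∈ (Icc 1 n).erase s, chord n s t = n := by
  rw [mem_Icc] at hs
  have hn : n ≠ 0 := by omega
  rw [← prod_chord_zero hn]
  refine Finset.prod_bij' (fun t _ => if t < s then s - t else s + n - t)
    (fun a _ => if a < s then s - a else s + n - a) ?_ ?_ ?_ ?_ ?_
  · intro t ht
    simp only [mem_erase, mem_Icc, mem_Ico] at ht ⊢
    split_ifs <;> omega
  · intro a ha
    simp only [mem_erase, mem_Icc, mem_Ico] at ha ⊢
    split_ifs <;> omega
  · intro t ht
    simp only [mem_erase, mem_Icc] at ht
    split_ifs <;> omega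
  · intro a ha
    simp only [mem_Ico] at ha
    split_ifs <;> omega
  · intro t ht
    simp only [mem_erase, mem_Icc] at ht
    split_ifs
    · exact chord_eq_chord_zero (by omega)
    · rw [← chord_add_left hn]
      exact chord_eq_chord_zero (by omega)

/-- The product of the chords joining points of `S` to points outside `S`. -/
noncomputable def crossProd (n : ℕ) (S : Finset ℕ) : ℝ :=
  ∏ s ∈ S, ∏ t ∈ Icc 1 n \ S, chord n s t

lemma crossProd_sdiff {n : ℕ} {S : Finset ℕ} (hS : S ⊆ Icc 1 n) :
    crossProd n (Icc 1 n \ S) = crossProd n S := by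
  unfold crossProd
  rw [Finset.sdiff_sdiff_eq_self hS, Finset.prod_comm]
  simp only [chord_comm]

lemma prod_chord_offDiag_mul_crossProd {n : ℕ} {S : Finset ℕ} (hS : S ⊆ Icc 1 n) :
    (∏ p ∈ (S ×ˢ S).filter (fun p => p.1 ≠ p.2), chord n p.1 p.2) * crossProd n S =
      (n : ℝ) ^ S.card := by
  have h : ∏ p ∈ (S ×ˢ S).filter (fun p => p.1 ≠ p.2), chord n p.1 p.2 =
      ∏ s ∈ S, ∏ t ∈ S.erase s, chord n s t := by
    rw [Finset.prod_filter, Finset.prod_product]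
    refine Finset.prod_congr rfl fun s _ => ?_
    rw [← Finset.prod_filter]
    refine Finset.prod_congr ?_ fun _ _ => rfl
    ext t
    simp only [mem_filter, mem_erase]
    tauto
  rw [h, crossProd, ← Finset.prod_mul_distrib, Finset.prod_congr rfl, Finset.prod_const]
  intro s hs
  rw [← prod_chord_erase (hS hs), ← Finset.prod_union]
  · refine Finset.prod_congr ?_ fun _ _ => rfl
    ext t
    have := @hS t
    simp only [mem_union, mem_erase, mem_sdiff]
    by_cases hts : t = s
    · subst hts
      tauto
    · tauto
  · refine Finset.disjoint_left.2 fun t ht ht' => ?_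
    exact (mem_sdiff.1 ht').2 (mem_of_mem_erase ht)

/-- The Verlinde number as a sum that is manifestly invariant under complementation. -/
lemma verlinde_succ_eq_sum_crossProd {r k : ℕ} (hr : 0 < r) (m : ℕ) :
    verlinde (m + 1) r k =
      ∑ S ∈ (Icc 1 (r + k)).powersetCard r, crossProd (r + k) S ^ m := by
  unfold verlinde
  rw [Finset.mul_sum]
  refine Finset.sum_congr rfl fun S hS => ?_
  obtain ⟨hSn, hSr⟩ := mem_powersetCard.1 hS
  have h := prod_chord_offDiag_mul_crossProd hSn
  rw [hSr] at h
  have hne : ((r + k : ℕ) : ℝ) ^ r ≠ 0 := by positivity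
  have hP := left_ne_zero_of_mul (h ▸ hne)
  have hexp : (1 - ((m + 1 : ℕ) : ℤ)) = -(m : ℤ) := by
    push_cast
    ring
  rw [hexp, Finset.prod_zpow, zpow_neg, zpow_natCast, Nat.add_sub_cancel, pow_mul]
  unfold chord at h hP
  push_cast at h hP
  rw [← h, mul_pow, mul_right_comm, mul_inv_cancel₀ (pow_ne_zero m hP), one_mul]

/-- Level-rank symmetry of the Verlinde numbers. -/
lemma verlinde_succ_symm {r k : ℕ} (hr : 0 < r) (hk : 0 < k) (m : ℕ) :
    verlinde (m + 1) r k = verlinde (m + 1) k r := by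
  rw [verlinde_succ_eq_sum_crossProd hr, verlinde_succ_eq_sum_crossProd hk, add_comm k r]
  have hmem : ∀ {a b : ℕ}, a + b = r + k → ∀ S ∈ (Icc 1 (r + k)).powersetCard a,
      Icc 1 (r + k) \ S ∈ (Icc 1 (r + k)).powersetCard b := by
    intro a b hab S hS
    obtain ⟨hSn, hSa⟩ := mem_powersetCard.1 hS
    refine mem_powersetCard.2 ⟨sdiff_subset, ?_⟩
    rw [card_sdiff_of_subset hSn, Nat.card_Icc, hSa]
    omega
  refine Finset.sum_bij' (fun S _ => Icc 1 (r + k) \ S) (fun S _ => Icc 1 (r + k) \ S)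
    (hmem rfl) (hmem (add_comm k r)) ?_ ?_ ?_
  · exact fun S hS => Finset.sdiff_sdiff_eq_self (mem_powersetCard.1 hS).1
  · exact fun S hS => Finset.sdiff_sdiff_eq_self (mem_powersetCard.1 hS).1
  · exact fun S hS => by rw [crossProd_sdiff (mem_powersetCard.1 hS).1]

/-- Level-rank symmetry of the multiplicities: `m_ω(r,k) = m_ω(k,r)`. -/
theorem mult_symm (g h r k ω : ℕ) (hg : 1 ≤ g) (hh : 0 < h) (hr : 0 < r) (hk : 0 < k)
    (hco : Nat.Coprime r k) (hω : ω ∣ h) (hωpos : 0 < ω) :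
    mult g h r k ω = mult g h k r ω := by
  unfold mult
  refine Finset.sum_congr rfl fun δ hδ => ?_
  have hδ0 : 0 < δ := Nat.pos_of_mem_divisors hδ
  rw [verlinde_succ_symm (Nat.mul_pos hr hδ0) (Nat.mul_pos hk hδ0), add_comm (r : ℝ) k]
end

section
/- Let g ≥ 1 be an integer, h a positive integer, and r, k coprime positive integers. Then Σ_{ω | h} n_g(ω) · m_ω(r,k) = v_g(hr, hk) / (r+k)^g, the sum being over all positive divisors ω of h. (This expresses that the multiplicities in the splitting of the Verlinde bundle correctly predict its rank.) -/
open Finset Real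

/-- `n_g(δ) = δ^{2g} · ∏_{p prime, p ∣ δ} (1 − p^{−2g})`. -/
noncomputable def jordanCount (g δ : ℕ) : ℝ :=
  (δ : ℝ) ^ (2 * g) * ∏ p ∈ δ.primeFactors, (1 - (p : ℝ) ^ (-(2 * (g : ℤ))))

/-- A product of powers of distinct primes divides `n` iff each of the powers does. -/
theorem prod_prime_pow_dvd_iff {s : Finset ℕ} (hs : ∀ p ∈ s, p.Prime) (e : ℕ → ℕ) (n : ℕ) :
    ∏ p ∈ s, p ^ e p ∣ n ↔ ∀ p ∈ s, p ^ e p ∣ n := by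
  refine ⟨fun h p hp => (dvd_prod_of_mem _ hp).trans h, fun h => ?_⟩
  refine Finset.prod_dvd_of_isRelPrime (fun p hp q hq hpq => ?_) h
  exact Nat.coprime_iff_isRelPrime.1
    (Nat.Coprime.pow _ _ ((Nat.coprime_primes (hs p hp) (hs q hq)).2 hpq))

theorem genusSymbol_eq_prod (g lam d : ℕ) :
    genusSymbol g lam d = ∏ p ∈ d.primeFactors,
      ((if p ^ d.factorization p ∣ lam then (1 : ℝ) else 0) -
        if p ^ (d.factorization p - 1) ∣ lam then (p : ℝ) ^ (-(2 * (g : ℤ))) else 0) := by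
  unfold genusSymbol
  split_ifs with h1 h2
  · simp [h1]
  · rw [prod_prime_pow_dvd_iff fun p => Nat.prime_of_mem_primeFactors] at h2
    exact prod_congr rfl fun p hp => by rw [if_pos (h2 p hp)]
  · rw [prod_prime_pow_dvd_iff fun p => Nat.prime_of_mem_primeFactors] at h2
    push Not at h2
    obtain ⟨p, hp, hpd⟩ := h2
    refine (prod_eq_zero hp ?_).symm
    rw [if_neg hpd, if_neg fun h => hpd ((pow_dvd_pow p (Nat.sub_le _ 1)).trans h), sub_zero]

theorem moebius_prod_primes {t : Finset ℕ} (ht : ∀ p ∈ t, p.Prime) :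
    ArithmeticFunction.moebius (∏ p ∈ t, p) = (-1) ^ #t := by
  rw [ArithmeticFunction.isMultiplicative_moebius.map_prod_of_prime t ht,
    prod_congr rfl fun p hp => ArithmeticFunction.moebius_apply_prime (ht p hp), prod_const]

/-- Sums over divisors weighted by the Möbius function are alternating sums over sets of
prime factors. -/
theorem sum_divisors_moebius_mul {R : Type*} [Ring R] {d : ℕ} (hd : d ≠ 0) (f : ℕ → R) :
    ∑ e ∈ d.divisors, (ArithmeticFunction.moebius e : R) * f e =
      ∑ t ∈ d.primeFactors.powerset, (-1) ^ #t * f (∏ p ∈ t, p) := by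
  have h : ∑ e ∈ d.divisors with Squarefree e, (ArithmeticFunction.moebius e : R) * f e =
      ∑ e ∈ d.divisors, (ArithmeticFunction.moebius e : R) * f e :=
    sum_filter_of_ne fun e _ he => by
      by_contra hsq
      simp [ArithmeticFunction.moebius_eq_zero_of_not_squarefree hsq] at he
  have hP : (UniqueFactorizationMonoid.normalizedFactors d).toFinset = d.primeFactors := by
    rw [Nat.factors_eq]; rfl
  rw [← h, Nat.sum_divisors_filter_squarefree hd, hP]
  refine sum_congr rfl fun t ht => ?_
  rw [prod_val, Function.id_def, moebius_prod_primes fun p hp =>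
    Nat.prime_of_mem_primeFactors (mem_powerset.1 ht hp)]
  push_cast
  rfl

theorem div_prod_primes {d : ℕ} (hd : d ≠ 0) {t : Finset ℕ} (ht : t ⊆ d.primeFactors) :
    d / ∏ p ∈ t, p = (∏ p ∈ d.primeFactors \ t, p ^ d.factorization p) *
      ∏ p ∈ t, p ^ (d.factorization p - 1) := by
  have hpos : 0 < ∏ p ∈ t, p := prod_pos fun p hp =>
    (Nat.prime_of_mem_primeFactors (ht hp)).pos
  refine Nat.div_eq_of_eq_mul_left hpos ?_
  rw [mul_assoc, ← prod_mul_distrib]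
  have h : ∏ p ∈ t, p ^ (d.factorization p - 1) * p = ∏ p ∈ t, p ^ d.factorization p :=
    prod_congr rfl fun p hp => by
      rw [← pow_succ, Nat.sub_add_cancel]
      exact (Nat.prime_of_mem_primeFactors (ht hp)).factorization_pos_of_dvd hd
        (Nat.dvd_of_mem_primeFactors (ht hp))
  rw [h, prod_sdiff ht]
  exact (Nat.prod_factorization_pow_eq_self hd).symm

/-- The genus symbol as a Ramanujan-type sum over divisors. -/
theorem genusSymbol_eq_sum_moebius (g lam : ℕ) {d : ℕ} (hd : d ≠ 0) :
    genusSymbol g lam d = ∑ e ∈ d.divisors, (ArithmeticFunction.moebius e : ℝ) *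
      if d / e ∣ lam then (e : ℝ) ^ (-(2 * (g : ℤ))) else 0 := by
  rw [genusSymbol_eq_prod, prod_sub,
    sum_divisors_moebius_mul hd fun e => if d / e ∣ lam then (e : ℝ) ^ (-(2 * (g : ℤ))) else 0]
  refine sum_congr rfl fun t ht => ?_
  have ht' := mem_powerset.1 ht
  have hprime : ∀ p ∈ t, p.Prime := fun p hp => Nat.prime_of_mem_primeFactors (ht' hp)
  have hprime' : ∀ p ∈ d.primeFactors \ t, p.Prime := fun p hp =>
    Nat.prime_of_mem_primeFactors (mem_sdiff.1 hp).1
  have hcop : (∏ p ∈ d.primeFactors \ t, p ^ d.factorization p).Coprime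
      (∏ p ∈ t, p ^ (d.factorization p - 1)) :=
    Nat.Coprime.prod_left fun p hp => Nat.Coprime.prod_right fun q hq =>
      Nat.Coprime.pow _ _ ((Nat.coprime_primes (hprime' p hp) (hprime q hq)).2
        fun h => (mem_sdiff.1 hp).2 (h ▸ hq))
  have hiff : d / ∏ p ∈ t, p ∣ lam ↔ (∀ p ∈ d.primeFactors \ t, p ^ d.factorization p ∣ lam) ∧
      ∀ p ∈ t, p ^ (d.factorization p - 1) ∣ lam := by
    rw [div_prod_primes hd ht', ← prod_prime_pow_dvd_iff hprime,
      ← prod_prime_pow_dvd_iff hprime']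
    exact ⟨fun h => ⟨(dvd_mul_right _ _).trans h, (dvd_mul_left _ _).trans h⟩,
      fun h => hcop.mul_dvd_of_dvd_of_dvd h.1 h.2⟩
  rw [mul_assoc, prod_ite_zero, prod_ite_zero, prod_const_one, prod_zpow, ← Nat.cast_prod]
  simp only [hiff]
  split_ifs <;> simp_all

theorem jordanCount_eq_sum_moebius (g : ℕ) {n : ℕ} (hn : n ≠ 0) :
    ∑ x ∈ n.divisorsAntidiagonal, (ArithmeticFunction.moebius x.1 : ℝ) * (x.2 : ℝ) ^ (2 * g) =
      jordanCount g n := by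
  have h : jordanCount g n = (n : ℝ) ^ (2 * g) * genusSymbol g 0 n := by
    rw [genusSymbol_eq_prod]
    simp [jordanCount]
  rw [h, genusSymbol_eq_sum_moebius g 0 hn, mul_sum,
    Nat.sum_divisorsAntidiagonal fun i j =>
      (ArithmeticFunction.moebius i : ℝ) * (j : ℝ) ^ (2 * g)]
  refine sum_congr rfl fun e he => ?_
  have he' := Nat.dvd_of_mem_divisors he
  have he0 : (e : ℝ) ≠ 0 := Nat.cast_ne_zero.2 (ne_zero_of_dvd_ne_zero hn he')
  rw [if_pos (dvd_zero _), Nat.cast_div he' he0, div_pow, zpow_neg]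
  norm_cast
  ring

theorem sum_divisors_jordanCount (g : ℕ) {n : ℕ} (hn : 0 < n) :
    ∑ ω ∈ n.divisors, jordanCount g ω = (n : ℝ) ^ (2 * g) :=
  (ArithmeticFunction.sum_eq_iff_sum_mul_moebius_eq
    (f := jordanCount g) (g := fun m => (m : ℝ) ^ (2 * g))).2
    (fun _ hm => jordanCount_eq_sum_moebius g hm.ne') n hn

theorem filter_divisors_dvd_div {h c : ℕ} (hh : h ≠ 0) (hc : c ∣ h) :
    {ω ∈ h.divisors | c ∣ h / ω} = (h / c).divisors := by
  obtain ⟨m, rfl⟩ := hc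
  have hc0 : 0 < c := Nat.pos_of_ne_zero (left_ne_zero_of_mul hh)
  rw [Nat.mul_div_cancel_left m hc0]
  ext ω
  simp only [mem_filter, Nat.mem_divisors]
  constructor
  · rintro ⟨⟨hω, -⟩, hd⟩
    refine ⟨?_, right_ne_zero_of_mul hh⟩
    rw [Nat.dvd_div_iff_mul_dvd hω, mul_comm] at hd
    exact Nat.dvd_of_mul_dvd_mul_left hc0 hd
  · rintro ⟨hω, -⟩
    have hω' : ω ∣ c * m := hω.mul_left c
    refine ⟨⟨hω', hh⟩, ?_⟩
    rw [Nat.dvd_div_iff_mul_dvd hω', mul_comm]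
    exact Nat.mul_dvd_mul_left c hω

/-- Orthogonality of the Jordan counts and the genus symbols. -/
theorem sum_jordanCount_mul_genusSymbol (g : ℕ) {h d : ℕ} (hh : h ≠ 0) (hd : d ∣ h) :
    ∑ ω ∈ h.divisors, jordanCount g ω * genusSymbol g (h / ω) d =
      if d = 1 then (h : ℝ) ^ (2 * g) else 0 := by
  have hd0 : d ≠ 0 := ne_zero_of_dvd_ne_zero hh hd
  calc ∑ ω ∈ h.divisors, jordanCount g ω * genusSymbol g (h / ω) d
    _ = ∑ e ∈ d.divisors, (ArithmeticFunction.moebius e : ℝ) * (e : ℝ) ^ (-(2 * (g : ℤ))) *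
          ∑ ω ∈ h.divisors with d / e ∣ h / ω, jordanCount g ω := by
      simp_rw [genusSymbol_eq_sum_moebius g _ hd0, mul_sum, sum_filter]
      rw [sum_comm]
      refine sum_congr rfl fun e _ => ?_
      refine sum_congr rfl fun ω _ => ?_
      split_ifs <;> ring
    _ = ∑ e ∈ d.divisors, (ArithmeticFunction.moebius e : ℝ) * ((h : ℝ) / d) ^ (2 * g) := by
      refine sum_congr rfl fun e he => ?_
      have he' := Nat.dvd_of_mem_divisors he
      have hed : d / e ∣ h := (Nat.div_dvd_of_dvd he').trans hd
      have he0 : (e : ℝ) ≠ 0 := Nat.cast_ne_zero.2 (ne_zero_of_dvd_ne_zero hd0 he')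
      have hdR : (d : ℝ) ≠ 0 := Nat.cast_ne_zero.2 hd0
      have hq : ((d / e : ℕ) : ℝ) = (d : ℝ) / e := Nat.cast_div he' he0
      rw [filter_divisors_dvd_div hh hed, sum_divisors_jordanCount g
        (Nat.div_pos (Nat.le_of_dvd (Nat.pos_of_ne_zero hh) hed)
          (Nat.pos_of_ne_zero (ne_zero_of_dvd_ne_zero hh hed))),
        Nat.cast_div hed (by rw [hq]; exact div_ne_zero hdR he0), hq, mul_assoc, zpow_neg,
        div_div_eq_mul_div, mul_div_right_comm, mul_pow,
        show (e : ℝ) ^ (2 * (g : ℤ)) = (e : ℝ) ^ (2 * g) by norm_cast,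
        mul_comm (((h : ℝ) / d) ^ (2 * g)), inv_mul_cancel_left₀ (pow_ne_zero _ he0)]
    _ = _ := by
      rw [← sum_mul, ← Int.cast_sum, ← ArithmeticFunction.coe_mul_zeta_apply,
        ArithmeticFunction.moebius_mul_coe_zeta, ArithmeticFunction.one_apply]
      split_ifs with h1 <;> simp [h1]

/-- The multiplicities in the splitting of the Verlinde bundle `E_{hr,hk}` correctly
predict its rank: `∑_{ω ∣ h} n_g(ω) · m_ω(r,k) = v_g(hr,hk)/(r+k)^g`. -/
theorem sum_mult_eq_rank (g h r k : ℕ) (hg : 1 ≤ g) (hh : 0 < h) (hr : 0 < r) (hk : 0 < k)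
    (hco : Nat.Coprime r k) :
    ∑ ω ∈ h.divisors, jordanCount g ω * mult g h r k ω =
      verlinde g (h * r) (h * k) / ((r : ℝ) + k) ^ g := by
  have hh0 := hh.ne'
  have hhR : (h : ℝ) ≠ 0 := Nat.cast_ne_zero.2 hh0
  calc ∑ ω ∈ h.divisors, jordanCount g ω * mult g h r k ω
    _ = ∑ δ ∈ h.divisors, (1 / (((r : ℝ) + k) ^ g * (δ : ℝ) ^ (2 * g))) *
          verlinde ((h / δ) * (g - 1) + 1) (r * δ) (k * δ) *
          ∑ ω ∈ h.divisors, jordanCount g ω * genusSymbol g (h / ω) (h / δ) := by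
      simp_rw [mult, mul_sum]
      rw [sum_comm]
      exact sum_congr rfl fun δ _ => sum_congr rfl fun ω _ => by ring
    _ = ∑ δ ∈ h.divisors, if δ = h then (1 / (((r : ℝ) + k) ^ g * (δ : ℝ) ^ (2 * g))) *
          verlinde ((h / δ) * (g - 1) + 1) (r * δ) (k * δ) * (h : ℝ) ^ (2 * g) else 0 := by
      refine sum_congr rfl fun δ hδ => ?_
      have hδ' := Nat.dvd_of_mem_divisors hδ
      rw [sum_jordanCount_mul_genusSymbol g hh0 (Nat.div_dvd_of_dvd hδ'), mul_ite, mul_zero]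
      refine if_congr ?_ rfl rfl
      rw [Nat.div_eq_iff_eq_mul_left (Nat.pos_of_mem_divisors hδ) hδ', one_mul, eq_comm]
    _ = _ := by
      rw [sum_ite_eq' h.divisors h, if_pos (Nat.mem_divisors_self h hh0), Nat.div_self hh, one_mul,
        Nat.sub_add_cancel hg, mul_comm r, mul_comm k]
      field_simp
end
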